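/- Assume the Klein–Gordon setup and let Δ be the Hill discriminant associated with P(z) = V''(f(z))/(c²−1) and period T. Let β ∈ ℝ with β ≠ 0 and set ν₀ := ν(iβ) = −β²/(c²−1)². Suppose Δ(ν₀) = 2ε with ε ∈ {1, −1}, Δ'(ν₀) = 0, and Δ''(ν₀) ≠ 0 (so ν₀ is a double point of the Hill spectrum). Then f exhibits a dynamical Hamiltonian–Hopf instability at iβ if and only if c²T²(c²−1)² = −2εβ²·Δ''(ν₀). -/

import Mathlib

open Real Filter Set

noncomputable section

/-- The (Floquet) spectrum of the linearized Klein--Gordon spectral problem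
`(c^2-1) w'' - 2 c lam w' + (lam^2 + Q z) w = 0`: the set of `lam : ℂ` for which
there is a nontrivial bounded solution `w : ℝ → ℂ`. -/
def KGSpectrum (c : ℝ) (Q : ℝ → ℝ) : Set ℂ :=
  {lam : ℂ | ∃ w wd wdd : ℝ → ℂ,
    (∀ z, HasDerivAt w (wd z) z) ∧ (∀ z, HasDerivAt wd (wdd z) z) ∧
    (∀ z : ℝ, ((c : ℂ) ^ 2 - 1) * wdd z - 2 * (c : ℂ) * lam * wd z
        + (lam ^ 2 + (Q z : ℂ)) * w z = 0) ∧
    (∃ z, w z ≠ 0) ∧ (∃ M : ℝ, ∀ z, ‖w z‖ ≤ M)}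

/-- The wave exhibits a dynamical Hamiltonian–Hopf instability at `lam` if every
neighborhood of `lam` contains a point of the spectrum that is not purely imaginary. -/
def HasDHHInstabilityAt (c : ℝ) (Q : ℝ → ℝ) (lam : ℂ) : Prop :=
  ∀ U ∈ nhds lam, ∃ μ ∈ KGSpectrum c Q, μ ∈ U ∧ μ.re ≠ 0

/-- `y1, y2` (with derivatives `y1d, y2d`) are the canonical fundamental solutions of
Hill's equation `y'' + P y = ν y` with `y1(0)=1, y1'(0)=0, y2(0)=0, y2'(0)=1`,
for every value of the spectral parameter `ν`. -/
def IsHillFundamental (P : ℝ → ℝ) (y1 y1d y2 y2d : ℝ → ℝ → ℝ) : Prop :=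
  ∀ ν : ℝ,
    (∀ z, HasDerivAt (y1 ν) (y1d ν z) z) ∧
    (∀ z, HasDerivAt (y1d ν) (ν * y1 ν z - P z * y1 ν z) z) ∧
    (∀ z, HasDerivAt (y2 ν) (y2d ν z) z) ∧
    (∀ z, HasDerivAt (y2d ν) (ν * y2 ν z - P z * y2 ν z) z) ∧
    y1 ν 0 = 1 ∧ y1d ν 0 = 0 ∧ y2 ν 0 = 0 ∧ y2d ν 0 = 1


/-- Picard iterates of the linear system with matrix K. -/
def volterraIter {E : Type*} [NormedAddCommGroup E] [NormedSpace ℂ E]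
    (K : ℝ → E →L[ℂ] E) (x0 : E) : ℕ → ℝ → E
  | 0 => fun _ => x0
  | n + 1 => fun z => ∫ t in (0:ℝ)..z, K t (volterraIter K x0 n t)

lemma volterraIter_cont {E : Type*} [NormedAddCommGroup E] [NormedSpace ℂ E] [CompleteSpace E]
    (K : ℝ → E →L[ℂ] E) (hK : Continuous K) (x0 : E) (n : ℕ) :
    Continuous (volterraIter K x0 n) := by
  induction n with
  | zero => exact continuous_const
  | succ n ih =>
    have h : Continuous fun t => K t (volterraIter K x0 n t) := hK.clm_apply ih
    exact intervalIntegral.continuous_primitive (fun a b => h.intervalIntegrable a b) 0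

lemma volterraIter_deriv {E : Type*} [NormedAddCommGroup E] [NormedSpace ℂ E] [CompleteSpace E]
    (K : ℝ → E →L[ℂ] E) (hK : Continuous K) (x0 : E) (n : ℕ) (z : ℝ) :
    HasDerivAt (volterraIter K x0 (n+1)) (K z (volterraIter K x0 n z)) z := by
  have h : Continuous fun t => K t (volterraIter K x0 n t) :=
    hK.clm_apply (volterraIter_cont K hK x0 n)
  exact intervalIntegral.integral_hasDerivAt_right (h.intervalIntegrable _ _)
    (h.stronglyMeasurableAtFilter _ _) h.continuousAt

lemma volterraIter_bound {E : Type*} [NormedAddCommGroup E] [NormedSpace ℂ E] [CompleteSpace E]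
    (K : ℝ → E →L[ℂ] E) (x0 : E) (R C : ℝ) (hC0 : 0 ≤ C)
    (hC : ∀ t, |t| ≤ R → ‖K t‖ ≤ C) (n : ℕ) :
    ∀ z, |z| ≤ R → ‖volterraIter K x0 n z‖ ≤ ‖x0‖ * C ^ n * |z| ^ n / n.factorial := by
  induction n with
  | zero => intro z hz; simp [volterraIter]
  | succ n ih =>
    intro z hz
    have h1 : ‖∫ t in (0:ℝ)..z, K t (volterraIter K x0 n t)‖ ≤
        |∫ t in (0:ℝ)..z, C * (‖x0‖ * C ^ n / n.factorial) * |t| ^ n| := by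
      apply intervalIntegral.norm_integral_le_abs_of_norm_le
      · refine (MeasureTheory.ae_restrict_iff' measurableSet_uIoc).2 (Eventually.of_forall ?_)
        intro t ht
        have ht' : |t| ≤ R := by
          rcases le_total 0 z with h | h
          · rw [uIoc_of_le h] at ht
            rw [abs_of_pos ht.1]; rw [abs_of_nonneg h] at hz; linarith [ht.2]
          · rw [uIoc_of_ge h] at ht
            rw [abs_of_nonpos ht.2]; rw [abs_of_nonpos h] at hz; linarith [ht.1]
        calc ‖K t (volterraIter K x0 n t)‖ ≤ ‖K t‖ * ‖volterraIter K x0 n t‖ :=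
              ContinuousLinearMap.le_opNorm _ _
          _ ≤ C * (‖x0‖ * C ^ n * |t| ^ n / n.factorial) := by
              gcongr
              · exact hC t ht'
              · exact ih t ht'
          _ = _ := by ring
      · apply Continuous.intervalIntegrable; fun_prop
    refine h1.trans (le_of_eq ?_)
    rw [intervalIntegral.abs_integral_eq_abs_integral_uIoc, MeasureTheory.integral_const_mul]
    have h2 := integral_pow_abs_sub_uIoc (a := 0) (b := z) n
    simp only [sub_zero] at h2
    rw [h2, abs_of_nonneg (by positivity), Nat.factorial_succ]
    push_cast
    field_simp
    ring

lemma volterra_exists {E : Type*} [NormedAddCommGroup E] [NormedSpace ℂ E] [CompleteSpace E]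
    (K : ℝ → E →L[ℂ] E) (hK : Continuous K) (x0 : E) :
    ∃ X : ℂ → ℝ → E, (∀ μ, X μ 0 = x0) ∧
      (∀ μ z, HasDerivAt (X μ) (μ • K z (X μ z)) z) ∧
      ∀ z, Differentiable ℂ (fun μ => X μ z) := by
  set x := volterraIter K x0 with hx
  have hCex : ∀ R : ℝ, ∃ C, 0 ≤ C ∧ ∀ t, |t| ≤ R → ‖K t‖ ≤ C := by
    intro R
    obtain ⟨C, hC⟩ := (isCompact_Icc (a := -R) (b := R)).exists_bound_of_continuousOn
      hK.continuousOn
    exact ⟨max C 0, le_max_right _ _, fun t ht => (hC t (abs_le.1 ht)).trans (le_max_left _ _)⟩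
  have hb : ∀ R : ℝ, 0 ≤ R → ∃ C, 0 ≤ C ∧ (∀ t, |t| ≤ R → ‖K t‖ ≤ C) ∧
      ∀ n z, |z| ≤ R → ‖x n z‖ ≤ ‖x0‖ * ((C * R) ^ n / n.factorial) := by
    intro R hR
    obtain ⟨C, hC0, hC⟩ := hCex R
    refine ⟨C, hC0, hC, fun n z hz => (volterraIter_bound K x0 R C hC0 hC n z hz).trans ?_⟩
    rw [mul_pow, mul_div_assoc, mul_assoc, mul_div_assoc]
    gcongr
  have hsummable : ∀ (a M : ℝ), Summable fun n : ℕ => a ^ n * (‖x0‖ * (M ^ n / n.factorial)) := by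
    intro a M
    have := (Real.summable_pow_div_factorial (a * M)).mul_left ‖x0‖
    refine this.congr fun n => ?_
    rw [mul_pow]; ring
  have hsum : ∀ (μ : ℂ) (z : ℝ), Summable fun n => μ ^ n • x n z := by
    intro μ z
    obtain ⟨C, hC0, hC, hbd⟩ := hb |z| (abs_nonneg _)
    refine Summable.of_norm_bounded (hsummable ‖μ‖ (C * |z|)) fun n => ?_
    rw [norm_smul, norm_pow]
    gcongr
    exact hbd n z le_rfl
  refine ⟨fun μ z => ∑' n, μ ^ n • x n z, ?_, ?_, ?_⟩
  · intro μ
    change ∑' n, μ ^ n • x n 0 = x0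
    rw [tsum_eq_single 0]
    · simp [hx, volterraIter]
    · intro n hn
      obtain ⟨m, rfl⟩ := Nat.exists_eq_succ_of_ne_zero hn
      simp [hx, volterraIter]
  · intro μ z
    set R := |z| + 1 with hR
    have hR0 : 0 ≤ R := by positivity
    obtain ⟨C, hC0, hC, hbd⟩ := hb R hR0
    have hder : ∀ (n : ℕ) (y : ℝ), y ∈ Metric.ball (0:ℝ) R →
        HasDerivAt (fun y => μ ^ (n+1) • x (n+1) y) (μ ^ (n+1) • K y (x n y)) y := by
      intro n y _
      exact (volterraIter_deriv K hK x0 n y).const_smul (μ ^ (n+1))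
    have hu : Summable fun n : ℕ => (‖μ‖ * C) * (‖μ‖ ^ n * (‖x0‖ * ((C * R) ^ n / n.factorial))) :=
      (hsummable ‖μ‖ (C * R)).mul_left _
    have hbd' : ∀ (n : ℕ) (y : ℝ), y ∈ Metric.ball (0:ℝ) R →
        ‖μ ^ (n+1) • K y (x n y)‖ ≤
          (‖μ‖ * C) * (‖μ‖ ^ n * (‖x0‖ * ((C * R) ^ n / n.factorial))) := by
      intro n y hy
      have hy' : |y| ≤ R := by
        have := Metric.mem_ball.1 hy
        rw [Real.dist_eq, sub_zero] at this
        exact this.le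
      rw [norm_smul, norm_pow, pow_succ]
      calc ‖μ‖ ^ n * ‖μ‖ * ‖K y (x n y)‖ ≤ ‖μ‖ ^ n * ‖μ‖ * (C * (‖x0‖ * ((C * R) ^ n / n.factorial))) := by
            gcongr
            refine (ContinuousLinearMap.le_opNorm _ _).trans ?_
            gcongr
            · exact hC y hy'
            · exact hbd n y hy'
        _ = _ := by ring
    have hz : z ∈ Metric.ball (0:ℝ) R := by
      rw [Metric.mem_ball, Real.dist_eq, sub_zero]; linarith
    have h0 : (0:ℝ) ∈ Metric.ball (0:ℝ) R := by
      rw [Metric.mem_ball, dist_self]; positivity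
    have key := hasDerivAt_tsum_of_isPreconnected hu Metric.isOpen_ball
      (convex_ball (0:ℝ) R).isPreconnected hder hbd' h0
      ((summable_nat_add_iff 1).2 (hsum μ 0)) hz
    have heq : (fun z => ∑' n, μ ^ n • x n z) = fun z => x0 + ∑' n, μ ^ (n+1) • x (n+1) z := by
      funext z
      rw [(hsum μ z).tsum_eq_zero_add]
      simp [hx, volterraIter]
    change HasDerivAt (fun z => ∑' n, μ ^ n • x n z) _ z
    rw [heq]
    have hval : (∑' n, μ ^ (n+1) • K z (x n z)) = μ • K z (∑' n, μ ^ n • x n z) := by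
      rw [(K z).map_tsum (hsum μ z), ← (((hsum μ z).mapL (K z))).tsum_const_smul]
      congr 1
      funext n
      rw [(K z).map_smul, smul_smul, pow_succ']
    rw [← hval]
    exact key.const_add x0
  · intro z
    obtain ⟨C, hC0, hC, hbd⟩ := hb |z| (abs_nonneg _)
    intro μ0
    have : DifferentiableOn ℂ (fun μ : ℂ => ∑' n, μ ^ n • x n z) (Metric.ball 0 (‖μ0‖ + 1)) := by
      refine Complex.differentiableOn_tsum_of_summable_norm (hsummable (‖μ0‖+1) (C * |z|)) ?_
        Metric.isOpen_ball ?_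
      · intro n; fun_prop
      · intro n μ hμ
        rw [norm_smul, norm_pow]
        have : ‖μ‖ ≤ ‖μ0‖ + 1 := by
          have := Metric.mem_ball.1 hμ
          rw [dist_zero_right] at this; exact this.le
        gcongr
        exact hbd n z le_rfl
    exact this.differentiableAt (Metric.isOpen_ball.mem_nhds (by simp))

/-- `y` (with derivative `yd`) solves the equation with potential q. -/
def IsSolC (q : ℝ → ℂ) (y yd : ℝ → ℂ) : Prop :=
  (∀ z, HasDerivAt y (yd z) z) ∧ (∀ z, HasDerivAt yd (q z * y z) z)

lemma const_of_deriv_zero (g : ℝ → ℂ) (h : ∀ z, HasDerivAt g 0 z) (z w : ℝ) : g z = g w :=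
  is_const_of_deriv_eq_zero (fun x => (h x).differentiableAt) (fun x => (h x).deriv) z w

lemma wronskian_const {q : ℝ → ℂ} {y yd u ud : ℝ → ℂ} (hy : IsSolC q y yd) (hu : IsSolC q u ud)
    (z : ℝ) : y z * ud z - yd z * u z = y 0 * ud 0 - yd 0 * u 0 := by
  refine const_of_deriv_zero (fun z => y z * ud z - yd z * u z) (fun z => ?_) z 0
  have := ((hy.1 z).mul (hu.2 z)).sub ((hy.2 z).mul (hu.1 z))
  refine this.congr_deriv ?_
  ring

/-- A canonical fundamental system. -/
def IsFundC (q : ℝ → ℂ) (a ad b bd : ℝ → ℂ) : Prop :=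
  IsSolC q a ad ∧ IsSolC q b bd ∧ a 0 = 1 ∧ ad 0 = 0 ∧ b 0 = 0 ∧ bd 0 = 1

lemma IsFundC.wronskian {q a ad b bd} (h : IsFundC q a ad b bd) (z : ℝ) :
    a z * bd z - ad z * b z = 1 := by
  rw [wronskian_const h.1 h.2.1 z, h.2.2.1, h.2.2.2.1, h.2.2.2.2.1, h.2.2.2.2.2]; ring

lemma IsFundC.repr {q a ad b bd} (h : IsFundC q a ad b bd) {y yd : ℝ → ℂ} (hy : IsSolC q y yd)
    (z : ℝ) : y z = y 0 * a z + yd 0 * b z ∧ yd z = y 0 * ad z + yd 0 * bd z := by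
  have hw := h.wronskian z
  have h1 := wronskian_const hy h.1 z
  have h2 := wronskian_const hy h.2.1 z
  rw [h.2.2.1, h.2.2.2.1] at h1
  rw [h.2.2.2.2.1, h.2.2.2.2.2] at h2
  constructor
  · linear_combination (-(y z)) * hw + a z * h2 - b z * h1
  · linear_combination (-(yd z)) * hw + ad z * h2 - bd z * h1

lemma IsSolC.shift {q y yd} (hy : IsSolC q y yd) (T : ℝ) (hq : ∀ z, q (z + T) = q z) :
    IsSolC q (fun z => y (z + T)) (fun z => yd (z + T)) := by
  refine ⟨fun z => (hy.1 (z + T)).comp_add_const z T, fun z => ?_⟩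
  have := (hy.2 (z + T)).comp_add_const z T
  rwa [hq] at this

lemma IsSolC.lincomb {q y yd u ud} (hy : IsSolC q y yd) (hu : IsSolC q u ud) (r s : ℂ) :
    IsSolC q (fun z => r * y z + s * u z) (fun z => r * yd z + s * ud z) := by
  refine ⟨fun z => ((hy.1 z).const_mul r).add ((hu.1 z).const_mul s), fun z => ?_⟩
  refine (((hy.2 z).const_mul r).add ((hu.2 z).const_mul s)).congr_deriv ?_
  ring

/-- Cayley–Hamilton for the monodromy. -/
lemma IsFundC.cayley {q a ad b bd} (h : IsFundC q a ad b bd) (T : ℝ) (hq : ∀ z, q (z + T) = q z)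
    {y yd : ℝ → ℂ} (hy : IsSolC q y yd) (z : ℝ) :
    y (z + T + T) - (a T + bd T) * y (z + T) + y z = 0 := by
  have hw := h.wronskian T
  have e0 := (h.repr hy z).1
  have e1 := (h.repr (hy.shift T hq) z).1
  have e2 := (h.repr ((hy.shift T hq).shift T hq) z).1
  have f0 := h.repr hy T
  have f1 := h.repr (hy.shift T hq) T
  simp only [zero_add] at e1 e2 f1
  rw [e2, e1, e0, f1.1, f1.2, f0.1, f0.2]
  linear_combination (-(y 0 * a z + yd 0 * b z)) * hw

/-- Floquet solutions exist for every root of the characteristic polynomial. -/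
lemma IsFundC.floquet {q a ad b bd} (h : IsFundC q a ad b bd) (T : ℝ) (hq : ∀ z, q (z + T) = q z)
    (ρ : ℂ) (hρ : ρ ^ 2 - (a T + bd T) * ρ + 1 = 0) :
    ∃ y yd, IsSolC q y yd ∧ (∃ z, y z ≠ 0) ∧ (∀ z, y (z + T) = ρ * y z) ∧
      (∀ z, yd (z + T) = ρ * yd z) := by
  have hw := h.wronskian T
  have hdet : (a T - ρ) * (bd T - ρ) - ad T * b T = 0 := by linear_combination hρ + hw
  have hv : ∃ r s : ℂ, (r ≠ 0 ∨ s ≠ 0) ∧ r * a T + s * b T = ρ * r ∧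
      r * ad T + s * bd T = ρ * s := by
    by_cases hb : b T = 0
    · by_cases hbd : bd T - ρ = 0
      · exact ⟨0, 1, Or.inr one_ne_zero, by rw [hb]; ring, by linear_combination hbd⟩
      · refine ⟨bd T - ρ, -ad T, Or.inl hbd, ?_, by ring⟩
        linear_combination hdet
    · exact ⟨b T, -(a T - ρ), Or.inl hb, by ring, by linear_combination -hdet⟩
  obtain ⟨r, s, hrs, h1, h2⟩ := hv
  have hy := h.1.lincomb h.2.1 r s
  have e : ∀ z, (r * a (z + T) + s * b (z + T) = ρ * (r * a z + s * b z)) ∧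
      (r * ad (z + T) + s * bd (z + T) = ρ * (r * ad z + s * bd z)) := by
    intro z
    have := h.repr (hy.shift T hq) z
    simp only [zero_add] at this
    rw [this.1, this.2, h1, h2]
    constructor <;> ring
  refine ⟨_, _, hy, ?_, fun z => (e z).1, fun z => (e z).2⟩
  by_contra hcon
  push Not at hcon
  have hr : r = 0 := by
    have := hcon 0
    rw [h.2.2.1, h.2.2.2.2.1] at this
    linear_combination this
  have hz : ∀ z, HasDerivAt (fun z => r * a z + s * b z) 0 z := by
    have : (fun z => r * a z + s * b z) = fun _ => 0 := funext hcon
    rw [this]; exact fun z => hasDerivAt_const _ _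
  have := (hy.1 0).unique (hz 0)
  simp only at this
  rw [h.2.2.2.1, h.2.2.2.2.2] at this
  rcases hrs with h' | h'
  · exact h' hr
  · exact h' (by linear_combination this)

/-- Self-adjointness: a unimodular multiplier forces a real spectral parameter. -/
lemma selfadjoint_real (P : ℝ → ℝ) (ν : ℂ) (T : ℝ) (hT : 0 < T) (y yd : ℝ → ℂ)
    (hy : IsSolC (fun z => ν - P z) y yd) (hne : ∃ z, y z ≠ 0) (ρ : ℂ) (hρ : ‖ρ‖ = 1)
    (h1 : ∀ z, y (z + T) = ρ * y z) (h2 : ∀ z, yd (z + T) = ρ * yd z) : ν.im = 0 := by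
  by_contra hν
  -- The function J, the imaginary part of yd times conj y, has derivative `Im ν * |y|^2` and is periodic
  set J : ℝ → ℝ := fun z => (yd z * (starRingEnd ℂ) (y z)).im with hJ
  have hJd : ∀ z, HasDerivAt J (ν.im * Complex.normSq (y z)) z := by
    intro z
    have hc : HasDerivAt (fun z => (starRingEnd ℂ) (y z)) ((starRingEnd ℂ) (yd z)) z := by
      exact (hy.1 z).star
    have hm := (hy.2 z).mul hc
    have := Complex.imCLM.hasFDerivAt.comp_hasDerivAt z hm
    refine this.congr_deriv ?_
    simp only [Complex.imCLM_apply, Complex.add_im, Complex.mul_im, Complex.mul_re,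
      Complex.conj_re, Complex.conj_im, Complex.sub_re, Complex.sub_im, Complex.ofReal_re,
      Complex.ofReal_im, Complex.normSq_apply]
    ring
  have hJp : ∀ z, J (z + T) = J z := by
    intro z
    simp only [hJ]
    rw [h1, h2, map_mul]
    have : ρ * yd z * ((starRingEnd ℂ) ρ * (starRingEnd ℂ) (y z)) =
      (ρ * (starRingEnd ℂ) ρ) * (yd z * (starRingEnd ℂ) (y z)) := by ring
    rw [this, Complex.mul_conj, Complex.normSq_eq_norm_sq, hρ]
    simp
  -- `G = J / Im ν` is monotone and periodic
  set G : ℝ → ℝ := fun z => J z / ν.im with hG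
  have hGd : ∀ z, HasDerivAt G (Complex.normSq (y z)) z := by
    intro z
    refine ((hJd z).div_const ν.im).congr_deriv ?_
    field_simp
  have hGp : ∀ z, G (z + T) = G z := fun z => by simp only [hG, hJp]
  have hmono : Monotone G := by
    apply monotone_of_deriv_nonneg (fun z => (hGd z).differentiableAt)
    intro z; rw [(hGd z).deriv]; exact Complex.normSq_nonneg _
  obtain ⟨z, hz⟩ := hne
  have hpos : 0 < Complex.normSq (y z) := Complex.normSq_pos.2 hz
  have hloc : ∀ᶠ w in nhdsWithin z (Ioi z), G w = G z := by
    have : Ioc z (z + T) ∈ nhdsWithin z (Ioi z) := Ioc_mem_nhdsGT (by linarith)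
    filter_upwards [this] with w hw
    apply le_antisymm
    · rw [← hGp z]; exact hmono hw.2
    · exact hmono hw.1.le
  have hd0 : HasDerivWithinAt G 0 (Ioi z) z :=
    (hasDerivWithinAt_const z (Ioi z) (G z)).congr_of_eventuallyEq hloc rfl
  have := (uniqueDiffWithinAt_Ioi z).eq_deriv _ (hGd z).hasDerivWithinAt hd0
  linarith

/-- Entire complexification of the fundamental system. -/
lemma hill_complex (P : ℝ → ℝ) (ν₀ : ℝ) (a ad b bd : ℝ → ℝ)
    (ha : ∀ z, HasDerivAt a (ad z) z) (had : ∀ z, HasDerivAt ad (ν₀ * a z - P z * a z) z)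
    (hb : ∀ z, HasDerivAt b (bd z) z) (hbd : ∀ z, HasDerivAt bd (ν₀ * b z - P z * b z) z)
    (h1 : a 0 = 1) (h2 : ad 0 = 0) (h3 : b 0 = 0) (h4 : bd 0 = 1) :
    ∃ Y1 Y1d Y2 Y2d : ℂ → ℝ → ℂ,
      (∀ ν, IsFundC (fun z => ν - P z) (Y1 ν) (Y1d ν) (Y2 ν) (Y2d ν)) ∧
      (∀ z, Differentiable ℂ fun ν => Y1 ν z) ∧ (∀ z, Differentiable ℂ fun ν => Y2d ν z) := by
  have haC : ∀ z, HasDerivAt (fun z => (a z : ℂ)) (ad z : ℂ) z := fun z => (ha z).ofReal_comp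
  have hbC : ∀ z, HasDerivAt (fun z => (b z : ℂ)) (bd z : ℂ) z := fun z => (hb z).ofReal_comp
  have hadC : ∀ z, HasDerivAt (fun z => (ad z : ℂ)) (((ν₀:ℂ) - P z) * a z) z := fun z => by
    refine (had z).ofReal_comp.congr_deriv ?_
    push_cast; ring
  have hbdC : ∀ z, HasDerivAt (fun z => (bd z : ℂ)) (((ν₀:ℂ) - P z) * b z) z := fun z => by
    refine (hbd z).ofReal_comp.congr_deriv ?_
    push_cast; ring
  have hF : IsFundC (fun z => (ν₀:ℂ) - P z) (fun z => (a z : ℂ)) (fun z => (ad z : ℂ))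
      (fun z => (b z : ℂ)) (fun z => (bd z : ℂ)) :=
    ⟨⟨haC, hadC⟩, ⟨hbC, hbdC⟩, by simp [h1], by simp [h2], by simp [h3], by simp [h4]⟩
  have hW : ∀ z, (a z : ℂ) * bd z - ad z * b z = 1 := hF.wronskian
  have hca : Continuous a := continuous_iff_continuousAt.2 fun z => (ha z).continuousAt
  have hcb : Continuous b := continuous_iff_continuousAt.2 fun z => (hb z).continuousAt
  set p1 := ContinuousLinearMap.fst ℂ ℂ ℂ
  set p2 := ContinuousLinearMap.snd ℂ ℂ ℂ
  set i1 := ContinuousLinearMap.inl ℂ ℂ ℂ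
  set i2 := ContinuousLinearMap.inr ℂ ℂ ℂ
  set K : ℝ → (ℂ × ℂ) →L[ℂ] (ℂ × ℂ) := fun z =>
    (-(a z * b z : ℂ)) • (i1.comp p1) + (-(b z * b z : ℂ)) • (i1.comp p2)
      + ((a z * a z : ℂ)) • (i2.comp p1) + ((a z * b z : ℂ)) • (i2.comp p2) with hKdef
  have hK : Continuous K := by
    simp only [hKdef]
    fun_prop
  have hKapp : ∀ z (x : ℂ × ℂ), K z x =
      (-(b z : ℂ) * (x.1 * a z + x.2 * b z), (a z : ℂ) * (x.1 * a z + x.2 * b z)) := by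
    intro z x
    simp only [hKdef, p1, p2, i1, i2]
    ext <;> simp <;> ring
  have main : ∀ x0 : ℂ × ℂ, ∃ Y Yd : ℂ → ℝ → ℂ,
      (∀ ν, IsSolC (fun z => ν - P z) (Y ν) (Yd ν)) ∧ (∀ ν, Y ν 0 = x0.1) ∧
      (∀ ν, Yd ν 0 = x0.2) ∧ (∀ z, Differentiable ℂ fun ν => Y ν z) ∧
      (∀ z, Differentiable ℂ fun ν => Yd ν z) := by
    intro x0
    obtain ⟨X, hX0, hXd, hXan⟩ := volterra_exists K hK x0
    have hd1 : ∀ μ z, HasDerivAt (fun z => (X μ z).1)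
        (μ * (-(b z : ℂ) * ((X μ z).1 * a z + (X μ z).2 * b z))) z := by
      intro μ z
      have := (p1.restrictScalars ℝ).hasFDerivAt.comp_hasDerivAt z (hXd μ z)
      refine this.congr_deriv ?_
      rw [hKapp]; simp [p1]
    have hd2 : ∀ μ z, HasDerivAt (fun z => (X μ z).2)
        (μ * ((a z : ℂ) * ((X μ z).1 * a z + (X μ z).2 * b z))) z := by
      intro μ z
      have := (p2.restrictScalars ℝ).hasFDerivAt.comp_hasDerivAt z (hXd μ z)
      refine this.congr_deriv ?_
      rw [hKapp]; simp [p2]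
    have ha1 : ∀ z, Differentiable ℂ fun μ => (X μ z).1 := fun z => (hXan z).fst
    have ha2 : ∀ z, Differentiable ℂ fun μ => (X μ z).2 := fun z => (hXan z).snd
    refine ⟨fun ν z => (X (ν - ν₀) z).1 * a z + (X (ν - ν₀) z).2 * b z,
      fun ν z => (X (ν - ν₀) z).1 * ad z + (X (ν - ν₀) z).2 * bd z, fun ν => ⟨fun z => ?_, fun z => ?_⟩,
      ?_, ?_, ?_, ?_⟩
    · refine (((hd1 (ν - ν₀) z).mul (haC z)).add ((hd2 (ν - ν₀) z).mul (hbC z))).congr_deriv ?_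
      ring
    · refine (((hd1 (ν - ν₀) z).mul (hadC z)).add ((hd2 (ν - ν₀) z).mul (hbdC z))).congr_deriv ?_
      linear_combination ((ν - ν₀) * ((X (ν - ν₀) z).1 * a z + (X (ν - ν₀) z).2 * b z)) * hW z
    · intro ν; simp [hX0, h1, h3]
    · intro ν; simp [hX0, h2, h4]
    · intro z
      have e1 : Differentiable ℂ fun ν : ℂ => (X (ν - ν₀) z).1 :=
        (ha1 z).comp (differentiable_id.sub_const _)
      have e2 : Differentiable ℂ fun ν : ℂ => (X (ν - ν₀) z).2 :=
        (ha2 z).comp (differentiable_id.sub_const _)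
      exact (e1.mul_const _).add (e2.mul_const _)
    · intro z
      have e1 : Differentiable ℂ fun ν : ℂ => (X (ν - ν₀) z).1 :=
        (ha1 z).comp (differentiable_id.sub_const _)
      have e2 : Differentiable ℂ fun ν : ℂ => (X (ν - ν₀) z).2 :=
        (ha2 z).comp (differentiable_id.sub_const _)
      exact (e1.mul_const _).add (e2.mul_const _)
  obtain ⟨Y1, Y1d, s1, i11, i12, an1, -⟩ := main (1, 0)
  obtain ⟨Y2, Y2d, s2, i21, i22, -, an2⟩ := main (0, 1)
  exact ⟨Y1, Y1d, Y2, Y2d, fun ν => ⟨s1 ν, s2 ν, i11 ν, i12 ν, i21 ν, i22 ν⟩, an1, an2⟩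

lemma bounded_mult_zero (p : ℝ → ℂ) (T : ℝ) (M : ℝ) (hM : ∀ z, ‖p z‖ ≤ M) (μ : ℂ)
    (hμ : ‖μ‖ ≠ 1) (hp : ∀ z, p (z + T) = μ * p z) (z : ℝ) : p z = 0 := by
  have hn : ∀ (n : ℕ) z, p (z + n * T) = μ ^ n * p z := by
    intro n
    induction n with
    | zero => intro z; simp
    | succ n ih =>
      intro z
      have : z + ((n + 1 : ℕ) : ℝ) * T = (z + n * T) + T := by push_cast; ring
      rw [this, hp, ih, pow_succ]; ring
  by_contra hz
  have hz' : 0 < ‖p z‖ := norm_pos_iff.2 hz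
  rcases lt_or_gt_of_ne hμ with h | h
  · have ht : Tendsto (fun n : ℕ => ‖μ‖ ^ n * M) atTop (nhds (0 * M)) :=
      (tendsto_pow_atTop_nhds_zero_of_lt_one (norm_nonneg _) h).mul_const M
    rw [zero_mul] at ht
    obtain ⟨n, hn'⟩ := ((tendsto_order.1 ht).2 _ hz').exists
    have h1 := hn n (z - n * T)
    rw [sub_add_cancel] at h1
    have : ‖p z‖ ≤ ‖μ‖ ^ n * M := by
      rw [h1, norm_mul, norm_pow]; gcongr; exact hM _
    linarith
  · have ht := tendsto_pow_atTop_atTop_of_one_lt h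
    obtain ⟨n, hn'⟩ := (ht.eventually_gt_atTop (M / ‖p z‖)).exists
    rw [div_lt_iff₀ hz'] at hn'
    have := hM (z + n * T)
    rw [hn, norm_mul, norm_pow] at this
    linarith

lemma spectrum_iff (c : ℝ) (hc : c ^ 2 ≠ 1) (Q P : ℝ → ℝ) (hP : P = fun z => Q z / (c ^ 2 - 1))
    (T : ℝ) (hT : 0 < T) (hper : ∀ z, P (z + T) = P z) (lam : ℂ) (a ad b bd : ℝ → ℂ)
    (h : IsFundC (fun z => (lam / ((c : ℂ) ^ 2 - 1)) ^ 2 - P z) a ad b bd) :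
    lam ∈ KGSpectrum c Q ↔ ∃ ρ : ℂ, ρ ^ 2 - (a T + bd T) * ρ + 1 = 0 ∧
      ‖Complex.exp (c * lam / ((c : ℂ) ^ 2 - 1) * T) * ρ‖ = 1 := by
  have hd : ((c : ℂ) ^ 2 - 1) ≠ 0 := by
    intro h0
    apply hc
    have : ((c ^ 2 - 1 : ℝ) : ℂ) = 0 := by push_cast; exact h0
    have := Complex.ofReal_eq_zero.1 this
    linarith
  have hPC : ∀ z, ((P z : ℝ) : ℂ) = Q z / ((c : ℂ) ^ 2 - 1) := by
    intro z; rw [hP]; push_cast; rfl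
  set d : ℂ := (c : ℂ) ^ 2 - 1 with hdd
  set α : ℂ := c * lam / d with hα
  have hq : ∀ z, (fun z => (lam / d) ^ 2 - (P z : ℂ)) (z + T) = (fun z => (lam / d) ^ 2 - (P z : ℂ)) z := by
    intro z; simp only [hper]
  have hexp : ∀ (r : ℂ) (z : ℝ), HasDerivAt (fun z : ℝ => Complex.exp (r * z)) (r * Complex.exp (r * z)) z := by
    intro r z
    have h1 : HasDerivAt (fun z : ℝ => r * (z : ℂ)) (r * 1) z :=
      (Complex.ofRealCLM.hasDerivAt (x := z)).const_mul r
    refine h1.cexp.congr_deriv ?_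
    ring
  constructor
  · rintro ⟨w, wd, wdd, hw, hwd, heq, ⟨z0, hz0⟩, M, hM⟩
    have hsol : IsSolC (fun z => (lam / d) ^ 2 - (P z : ℂ))
        (fun z => Complex.exp (-α * z) * w z)
        (fun z => Complex.exp (-α * z) * (wd z - α * w z)) := by
      refine ⟨fun z => ?_, fun z => ?_⟩
      · refine ((hexp (-α) z).mul (hw z)).congr_deriv ?_
        ring
      · refine ((hexp (-α) z).mul ((hwd z).sub ((hw z).const_mul α))).congr_deriv ?_
        have e := heq z
        have e' : wdd z = (2 * c * lam * wd z - (lam ^ 2 + Q z) * w z) / d := by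
          rw [eq_div_iff hd]; linear_combination e
        simp only [hPC, Pi.sub_apply]
        rw [e', hα]
        have hc2 : (c : ℂ) ^ 2 = d + 1 := by rw [hdd]; ring
        field_simp
        linear_combination Complex.exp (-(z * c * lam / d)) * w z * lam ^ 2 * hc2
    have hCH := h.cayley T hq hsol
    set D := a T + bd T
    obtain ⟨ρ, hρ⟩ : ∃ ρ : ℂ, ρ ^ 2 - D * ρ + 1 = 0 := by
      obtain ⟨s, hs⟩ := IsAlgClosed.exists_pow_nat_eq (D ^ 2 - 4) (n := 2) (by norm_num)
      exact ⟨(D + s) / 2, by linear_combination hs / 4⟩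
    set E := Complex.exp (α * T) with hE
    have hE0 : E ≠ 0 := Complex.exp_ne_zero _
    have hwrec : ∀ z, w (z + T + T) - E * D * w (z + T) + E ^ 2 * w z = 0 := by
      intro z
      have e := hCH z
      have e1 : Complex.exp (-α * ((z + T : ℝ) : ℂ)) * E = Complex.exp (-α * z) := by
        rw [hE, ← Complex.exp_add]; congr 1; push_cast; ring
      have e2 : Complex.exp (-α * ((z + T + T : ℝ) : ℂ)) * E = Complex.exp (-α * ((z + T : ℝ) : ℂ)) := by
        rw [hE, ← Complex.exp_add]; congr 1; push_cast; ring
      rw [← e1, ← e2] at e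
      have e0 := Complex.exp_ne_zero (-α * ((z + T + T : ℝ) : ℂ))
      apply mul_left_cancel₀ e0
      linear_combination e
    have hsum : ρ + (D - ρ) = D := by ring
    have hprod : ρ * (D - ρ) = 1 := by linear_combination -hρ
    by_contra hcon
    push Not at hcon
    have n1 := hcon ρ hρ
    have n2 := hcon (D - ρ) (by linear_combination hρ)
    have hM' : ∀ z, ‖w (z + T) - E * ρ * w z‖ ≤ M + ‖E * ρ‖ * M := by
      intro z
      refine (norm_sub_le _ _).trans ?_
      rw [norm_mul (E * ρ)]
      gcongr
      · exact hM _
      · exact hM _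
    have p0 : ∀ z, w (z + T) - E * ρ * w z = 0 := by
      refine bounded_mult_zero (fun z => w (z + T) - E * ρ * w z) T _ hM' (E * (D - ρ)) n2 ?_
      intro z
      linear_combination hwrec z + E ^ 2 * w z * hprod
    have := bounded_mult_zero w T M hM (E * ρ) n1 (fun z => by linear_combination p0 z) z0
    exact hz0 this
  · rintro ⟨ρ, hρ, hn⟩
    obtain ⟨y, yd, hy, ⟨z0, hz0⟩, hyT, -⟩ := h.floquet T hq ρ hρ
    refine ⟨fun z => Complex.exp (α * z) * y z, fun z => Complex.exp (α * z) * (yd z + α * y z),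
      fun z => Complex.exp (α * z) * (((lam / d) ^ 2 - P z) * y z + α * yd z + α * (yd z + α * y z)),
      ?_, ?_, ?_, ⟨z0, mul_ne_zero (Complex.exp_ne_zero _) hz0⟩, ?_⟩
    · intro z
      refine ((hexp α z).mul (hy.1 z)).congr_deriv ?_
      ring
    · intro z
      refine ((hexp α z).mul ((hy.2 z).add ((hy.1 z).const_mul α))).congr_deriv ?_
      simp only [Pi.add_apply]
      ring
    · intro z
      simp only [hPC]
      rw [← hdd, hα]
      have hc2 : (c : ℂ) ^ 2 = d + 1 := by rw [hdd]; ring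
      field_simp
      linear_combination (-(lam ^ 2 * y z)) * hc2
    · set w := fun z : ℝ => Complex.exp (α * z) * y z with hw
      have hcont : Continuous w := continuous_iff_continuousAt.2 fun z =>
        ((hexp α z).mul (hy.1 z)).continuousAt
      have hper' : Function.Periodic (fun z => ‖w z‖) T := by
        intro z
        have : w (z + T) = (Complex.exp (α * T) * ρ) * w z := by
          simp only [hw]
          rw [hyT]
          push_cast
          rw [mul_add, Complex.exp_add]; ring
        simp only [this]
        rw [norm_mul, hn, one_mul]
      obtain ⟨M, hM⟩ := (isCompact_Icc (a := (0:ℝ)) (b := T)).exists_bound_of_continuousOn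
        hcont.continuousOn
      refine ⟨M, fun z => ?_⟩
      obtain ⟨z', hz', he⟩ := hper'.exists_mem_Ico₀ hT z
      rw [he]
      exact hM z' ⟨hz'.1, hz'.2.le⟩

lemma spectrum_iff_cos (c : ℝ) (hc : c ^ 2 ≠ 1) (Q P : ℝ → ℝ)
    (hP : P = fun z => Q z / (c ^ 2 - 1))
    (T : ℝ) (hT : 0 < T) (hper : ∀ z, P (z + T) = P z) (s : ℂ) (a ad b bd : ℝ → ℂ)
    (h : IsFundC (fun z => -s ^ 2 / ((c : ℂ) ^ 2 - 1) ^ 2 - P z) a ad b bd) :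
    Complex.I * s ∈ KGSpectrum c Q ↔ ∃ θ : ℝ,
      a T + bd T = 2 * Complex.cos (((c * T / (c ^ 2 - 1) : ℝ) : ℂ) * s - θ) := by
  have hν : -s ^ 2 / ((c : ℂ) ^ 2 - 1) ^ 2 = (Complex.I * s / ((c : ℂ) ^ 2 - 1)) ^ 2 := by
    rw [div_pow, mul_pow, Complex.I_sq]; ring
  rw [hν] at h
  rw [spectrum_iff c hc Q P hP T hT hper _ a ad b bd h]
  set D := a T + bd T
  set k : ℝ := c * T / (c ^ 2 - 1) with hk
  have hks : (c : ℂ) * (Complex.I * s) / ((c : ℂ) ^ 2 - 1) * T = k * s * Complex.I := by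
    rw [hk]; push_cast; ring
  rw [hks]
  constructor
  · rintro ⟨ρ, hρ, hn⟩
    obtain ⟨θ, hθ⟩ := (Complex.norm_eq_one_iff _).1 hn
    refine ⟨θ, ?_⟩
    have hρ' : ρ = Complex.exp (-(k * s - θ) * Complex.I) := by
      have : -(k * s - θ) * Complex.I = θ * Complex.I - k * s * Complex.I := by ring
      rw [this, Complex.exp_sub, hθ]
      field_simp [Complex.exp_ne_zero]
    have hinv : ρ * Complex.exp ((k * s - θ) * Complex.I) = 1 := by
      rw [hρ', ← Complex.exp_add, ← Complex.exp_zero]; congr 1; ring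
    rw [Complex.two_cos, ← hρ']
    have hρ0 : ρ ≠ 0 := by rw [hρ']; exact Complex.exp_ne_zero _
    apply mul_left_cancel₀ hρ0
    linear_combination -hρ - hinv
  · rintro ⟨θ, hθ⟩
    refine ⟨Complex.exp (-(k * s - θ) * Complex.I), ?_, ?_⟩
    · rw [hθ, Complex.two_cos]
      have hinv : Complex.exp (-(k * s - θ) * Complex.I) * Complex.exp ((k * s - θ) * Complex.I) = 1 := by
        rw [← Complex.exp_add, ← Complex.exp_zero]; congr 1; ring
      linear_combination -hinv
    · rw [← Complex.exp_add]
      have : k * s * Complex.I + -(k * s - θ) * Complex.I = θ * Complex.I := by ring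
      rw [this, Complex.norm_exp_ofReal_mul_I]

lemma potential_periodic (V : ℝ → ℝ) (c : ℝ)
    (f fd fdd : ℝ → ℝ)
    (hf : ∀ z, HasDerivAt f (fd z) z)
    (hfd : ∀ z, HasDerivAt fd (fdd z) z)
    (hwave : ∀ z, (c ^ 2 - 1) * fdd z + deriv V (f z) = 0)
    (T : ℝ) (hper : ∀ z, fd (z + T) = fd z) (z : ℝ) :
    deriv (deriv V) (f (z + T)) = deriv (deriv V) (f z) := by
  have hK : ∀ z, f (z + T) - f z = f (0 + T) - f 0 := by
    intro z
    refine is_const_of_deriv_eq_zero (f := fun z => f (z + T) - f z) (fun x => ?_) (fun x => ?_) z 0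
    · exact (((hf (x + T)).comp_add_const x T).sub (hf x)).differentiableAt
    · refine (((hf (x + T)).comp_add_const x T).sub (hf x)).deriv.trans ?_
      rw [hper, sub_self]
  set K := f (0 + T) - f 0
  have hK' : ∀ z, f (z + T) = f z + K := fun z => by linarith [hK z]
  have hfdd : ∀ z, fdd (z + T) = fdd z := by
    intro z
    have h1 := (hfd (z + T)).comp_add_const z T
    have h2 : (fun z => fd (z + T)) = fd := funext hper
    rw [h2] at h1
    exact h1.unique (hfd z)
  have hV' : ∀ z, deriv V (f z + K) = deriv V (f z) := by
    intro z
    have h1 := hwave (z + T)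
    rw [hfdd, hK'] at h1
    linarith [hwave z]
  by_cases hK0 : K = 0
  · rw [hK', hK0, add_zero]
  have hcont : Continuous f := continuous_iff_continuousAt.2 fun z => (hf z).continuousAt
  have hn : ∀ (n : ℕ) z, f (z + n * T) = f z + n * K := by
    intro n
    induction n with
    | zero => intro z; simp
    | succ n ih =>
      intro z
      have : z + ((n + 1 : ℕ) : ℝ) * T = (z + n * T) + T := by push_cast; ring
      rw [this, hK', ih]; push_cast; ring
  have hm : ∀ (n : ℕ), f (-(n * T)) = f 0 - n * K := by
    intro n
    have := hn n (-(n * T))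
    rw [neg_add_cancel] at this
    linarith
  have hp : ∀ (n : ℕ), f (n * T) = f 0 + n * K := by
    intro n; have := hn n 0; rwa [zero_add] at this
  have hsurj : ∀ u, u ∈ range f := by
    intro u
    obtain ⟨n, hn'⟩ := exists_nat_ge (|u - f 0| / |K|)
    rw [div_le_iff₀ (abs_pos.2 hK0)] at hn'
    have hb := abs_le.1 hn'
    rcases lt_or_gt_of_ne hK0 with h | h
    · rw [abs_of_neg h] at hb
      exact mem_range_of_exists_le_of_exists_ge hcont ⟨n * T, by rw [hp]; linarith [hb.1]⟩
        ⟨-(n * T), by rw [hm]; linarith [hb.2]⟩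
    · rw [abs_of_pos h] at hb
      exact mem_range_of_exists_le_of_exists_ge hcont ⟨-(n * T), by rw [hm]; linarith [hb.1]⟩
        ⟨n * T, by rw [hp]; linarith [hb.2]⟩
  have hfun : (fun u => deriv V (u + K)) = deriv V := by
    funext u
    obtain ⟨x, rfl⟩ := hsurj u
    exact hV' x
  rw [hK', ← deriv_comp_add_const, hfun]

lemma analytic_root (h : ℂ → ℂ) (z0 : ℂ) (hh : AnalyticAt ℂ h z0) (h0 : h z0 ≠ 0) (n : ℕ)
    (hn : n ≠ 0) : ∃ r : ℂ → ℂ, AnalyticAt ℂ r z0 ∧ r z0 ≠ 0 ∧ ∀ᶠ z in nhds z0, r z ^ n = h z := by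
  obtain ⟨w0, hw0⟩ := IsAlgClosed.exists_pow_nat_eq (h z0) (n := n) (Nat.pos_of_ne_zero hn)
  have hw0' : w0 ≠ 0 := by
    rintro rfl; rw [zero_pow hn] at hw0; exact h0 hw0.symm
  have hlog : AnalyticAt ℂ (fun z => Complex.log (h z / h z0)) z0 := by
    apply AnalyticAt.clog
    · exact hh.div analyticAt_const h0
    · rw [div_self h0]; exact Complex.one_mem_slitPlane
  refine ⟨fun z => w0 * Complex.exp (Complex.log (h z / h z0) / n), ?_, ?_, ?_⟩
  · exact analyticAt_const.mul (hlog.div_const).cexp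
  · exact mul_ne_zero hw0' (Complex.exp_ne_zero _)
  · filter_upwards [hh.continuousAt.eventually_ne h0] with z hz
    rw [mul_pow, hw0, ← Complex.exp_nat_mul, mul_div_cancel₀ _ (Nat.cast_ne_zero.2 hn),
      Complex.exp_log (div_ne_zero hz h0), mul_div_cancel₀ _ h0]

lemma normal_form (g : ℂ → ℂ) (z0 : ℂ) (hg : AnalyticAt ℂ g z0) (h0 : g z0 = 0)
    (hne : ¬ ∀ᶠ z in nhds z0, g z = 0) :
    ∃ (n : ℕ) (q : ℂ → ℂ), n ≠ 0 ∧ AnalyticAt ℂ q z0 ∧ q z0 = 0 ∧ deriv q z0 ≠ 0 ∧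
      ∀ᶠ z in nhds z0, g z = q z ^ n := by
  obtain ⟨n, h, hh, hh0, hev⟩ := hg.exists_eventuallyEq_pow_smul_nonzero_iff.2 hne
  have hn : n ≠ 0 := by
    rintro rfl
    have := hev.self_of_nhds
    rw [h0] at this
    simp at this
    exact hh0 this.symm
  obtain ⟨r, hr, hr0, hrev⟩ := analytic_root h z0 hh hh0 n hn
  have hd : HasDerivAt (fun z => (z - z0) * r z) (r z0) z0 := by
    refine (((hasDerivAt_id z0).sub_const z0).mul hr.differentiableAt.hasDerivAt).congr_deriv ?_
    simp
  refine ⟨n, fun z => (z - z0) * r z, hn, ?_, by simp, ?_, ?_⟩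
  · exact (analyticAt_id.sub analyticAt_const).mul hr
  · rw [hd.deriv]; exact hr0
  · filter_upwards [hev, hrev] with z h1 h2
    rw [h1, mul_pow, h2, smul_eq_mul]

/-- If `φ` is a local biholomorphism at `z0` and the preimage of the line `ℝ v` is horizontal,
then v divided by the derivative is real. -/
lemma curve_real (φ : ℂ → ℂ) (z0 m v : ℂ) (hφ : HasStrictDerivAt φ m z0) (hm : m ≠ 0)
    (h0 : φ z0 = 0)
    (h : ∀ᶠ z in nhds z0, (∃ t : ℝ, φ z = t * v) → z.im = 0) : (v / m).im = 0 := by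
  set ψ := hφ.localInverse φ m z0 hm with hψ
  have hd : HasDerivAt ψ m⁻¹ (φ z0) := (hφ.to_localInverse hm).hasDerivAt
  have hr : ∀ᶠ x in nhds (φ z0), φ (ψ x) = x := hφ.eventually_right_inverse hm
  have hl : ψ (φ z0) = z0 := (hφ.eventually_left_inverse hm).self_of_nhds
  rw [h0] at hd hr hl
  have hcurve : HasDerivAt (fun t : ℝ => (t : ℂ) * v) v 0 := by
    refine ((Complex.ofRealCLM.hasDerivAt (x := (0:ℝ))).mul_const v).congr_deriv ?_
    simp
  have hc0 : ((0:ℝ) : ℂ) * v = 0 := by simp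
  have ht : Tendsto (fun t : ℝ => (t : ℂ) * v) (nhds 0) (nhds 0) := by
    have := hcurve.continuousAt.tendsto
    rwa [hc0] at this
  have hψt : Tendsto ψ (nhds 0) (nhds z0) := by
    have := hd.continuousAt.tendsto
    rwa [hl] at this
  have hcomp : HasDerivAt (fun t : ℝ => ψ ((t : ℂ) * v)) (m⁻¹ * v) 0 := by
    rw [← hc0] at hd
    exact hd.comp (0:ℝ) hcurve
  have him : HasDerivAt (fun t : ℝ => (ψ ((t : ℂ) * v)).im) (m⁻¹ * v).im 0 :=
    Complex.imCLM.hasFDerivAt.comp_hasDerivAt (0:ℝ) hcomp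
  have hev : (fun t : ℝ => (ψ ((t : ℂ) * v)).im) =ᶠ[nhds 0] fun _ => 0 := by
    filter_upwards [ht.eventually hr, (hψt.comp ht).eventually h] with t h1 h2
    exact h2 ⟨t, h1⟩
  have := him.unique ((hasDerivAt_const (0:ℝ) (0:ℝ)).congr_of_eventuallyEq hev)
  rw [div_eq_inv_mul]; exact this

/-- Phase function: near a double point, `D = 2 ε cos φ`. -/
lemma exists_phase (D : ℂ → ℂ) (hD : Differentiable ℂ D) (z0 ε d : ℂ) (hε : ε ^ 2 = 1)
    (hval : D z0 = 2 * ε) (h1 : deriv D z0 = 0) (h2 : deriv (deriv D) z0 = d) (hd : d ≠ 0) :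
    ∃ (φ : ℂ → ℂ) (m : ℂ), AnalyticAt ℂ φ z0 ∧ φ z0 = 0 ∧ HasStrictDerivAt φ m z0 ∧
      m ^ 2 = - ε * d / 2 ∧ ∀ᶠ z in nhds z0, D z = 2 * ε * Complex.cos (φ z) := by
  have hε0 : ε ≠ 0 := by rintro rfl; norm_num at hε
  have hDan : ∀ z, AnalyticAt ℂ D z := fun z => hD.analyticAt z
  set G : ℂ → ℂ := fun z => D z ^ 2 - 4 with hG
  have hGan : AnalyticAt ℂ G z0 := ((hDan z0).pow 2).sub analyticAt_const
  have hG0 : G z0 = 0 := by simp only [hG, hval]; linear_combination 4 * hε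
  have hGd : ∀ z, HasDerivAt G (2 * D z * deriv D z) z := by
    intro z
    refine (((hD z).hasDerivAt.pow 2).sub_const 4).congr_deriv ?_
    simp
  have hGd' : deriv G = fun z => 2 * D z * deriv D z := funext fun z => (hGd z).deriv
  have hDd : HasDerivAt (deriv D) d z0 := by
    rw [← h2]; exact (hDan z0).deriv.differentiableAt.hasDerivAt
  have hGdd : HasDerivAt (deriv G) (4 * ε * d) z0 := by
    rw [hGd']
    refine (((hD z0).hasDerivAt.const_mul 2).mul hDd).congr_deriv ?_
    rw [h1, hval]; ring
  have hGne : ¬ ∀ᶠ z in nhds z0, G z = 0 := by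
    intro hev
    have e1 : deriv G =ᶠ[nhds z0] deriv (fun _ => (0:ℂ)) := EventuallyEq.deriv hev
    have := e1.deriv_eq
    rw [hGdd.deriv] at this
    simp at this
    tauto
  obtain ⟨n, q, hn, hq, hq0, hq1, hev⟩ := normal_form G z0 hGan hG0 hGne
  have hdG : deriv G =ᶠ[nhds z0] fun z => n * q z ^ (n - 1) * deriv q z := by
    have : G =ᶠ[nhds z0] fun z => q z ^ n := hev
    refine (EventuallyEq.deriv this).trans ?_
    filter_upwards [hq.eventually_analyticAt] with z hz
    exact (hz.differentiableAt.hasDerivAt.pow n).deriv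
  have hn1 : n ≠ 1 := by
    rintro rfl
    have := hdG.self_of_nhds
    rw [(hGd z0).deriv, h1] at this
    simp at this
    exact hq1 this.symm
  have hqd := hq.differentiableAt.hasDerivAt
  have hddG : 4 * ε * d = n * ((n - 1 : ℕ) * q z0 ^ (n - 1 - 1) * deriv q z0) * deriv q z0
      + n * q z0 ^ (n - 1) * deriv (deriv q) z0 := by
    have e := ((hqd.pow (n - 1)).const_mul (n:ℂ)).mul hq.deriv.differentiableAt.hasDerivAt
    exact hGdd.unique (e.congr_of_eventuallyEq hdG)
  have hn2 : n = 2 := by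
    by_contra hne
    have : n - 1 - 1 ≠ 0 := by omega
    have h' : n - 1 ≠ 0 := by omega
    rw [hq0, zero_pow this, zero_pow h'] at hddG
    simp at hddG
    tauto
  subst hn2
  have hq2 : deriv q z0 ^ 2 = 2 * ε * d := by
    rw [hq0] at hddG
    norm_num at hddG
    linear_combination -hddG / 2
  set E : ℂ → ℂ := fun z => (ε * D z + q z) / 2 with hE
  have hEan : AnalyticAt ℂ E z0 := ((analyticAt_const.mul (hDan z0)).add hq).div_const
  have hE1 : E z0 = 1 := by simp only [hE, hval, hq0]; linear_combination hε
  have hEd : HasDerivAt E (deriv q z0 / 2) z0 := by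
    refine ((((hD z0).hasDerivAt.const_mul ε).add hqd).div_const 2).congr_deriv ?_
    rw [h1]; ring
  have hsl : E z0 ∈ Complex.slitPlane := by rw [hE1]; exact Complex.one_mem_slitPlane
  have hφan : AnalyticAt ℂ (fun z => -Complex.I * Complex.log (E z)) z0 :=
    analyticAt_const.mul (hEan.clog hsl)
  have hφd : HasDerivAt (fun z => -Complex.I * Complex.log (E z)) (-Complex.I * (deriv q z0 / 2)) z0 := by
    refine ((hEd.clog hsl).const_mul (-Complex.I)).congr_deriv ?_
    rw [hE1, div_one]
  refine ⟨fun z => -Complex.I * Complex.log (E z), -Complex.I * (deriv q z0 / 2), hφan, ?_, ?_, ?_, ?_⟩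
  · simp only [hE1, Complex.log_one, mul_zero]
  · have := hφan.hasStrictDerivAt
    rwa [hφd.deriv] at this
  · rw [mul_pow, neg_sq, Complex.I_sq, div_pow, hq2]; ring
  · filter_upwards [hev, hEan.continuousAt.eventually_ne (by rw [hE1]; exact one_ne_zero)] with z hz hEz
    have e1 : -Complex.I * Complex.log (E z) * Complex.I = Complex.log (E z) := by
      linear_combination (-Complex.log (E z)) * Complex.I_sq
    have e2 : -(-Complex.I * Complex.log (E z)) * Complex.I = -Complex.log (E z) := by
      linear_combination (Complex.log (E z)) * Complex.I_sq
    have h2c := Complex.two_cos (-Complex.I * Complex.log (E z))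
    rw [e1, e2, Complex.exp_neg, Complex.exp_log hEz] at h2c
    have hinv : (E z)⁻¹ = (ε * D z - q z) / 2 := by
      apply inv_eq_of_mul_eq_one_right
      simp only [hE]
      simp only [hG] at hz
      linear_combination (D z ^ 2 / 4) * hε + hz / 4
    rw [hinv] at h2c
    simp only [hE] at h2c ⊢
    linear_combination (-ε) * h2c - D z * hε

lemma phase_conj (D φ : ℂ → ℂ) (β : ℝ) (ε m : ℂ) (hε : ε ≠ 0)
    (hconj : ∀ z, D ((starRingEnd ℂ) z) = (starRingEnd ℂ) (D z)) (hεc : (starRingEnd ℂ) ε = ε)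
    (h0 : φ β = 0) (hd : HasDerivAt φ m β) (hm : m ≠ 0) (hmr : (starRingEnd ℂ) m = m)
    (hev : ∀ᶠ z in nhds (β:ℂ), D z = 2 * ε * Complex.cos (φ z)) :
    ∀ᶠ z in nhds (β:ℂ), φ ((starRingEnd ℂ) z) = (starRingEnd ℂ) (φ z) := by
  have hct : Tendsto (starRingEnd ℂ) (nhds (β:ℂ)) (nhds (β:ℂ)) := by
    have := (Complex.continuous_conj.tendsto (β:ℂ))
    rwa [Complex.conj_ofReal] at this
  set χ : ℂ → ℂ := fun z => (starRingEnd ℂ) (φ ((starRingEnd ℂ) z)) with hχ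
  have hχd : HasDerivAt χ m (β:ℂ) := by
    have hd' := hd
    rw [← Complex.conj_ofReal] at hd'
    have := HasDerivAt.conj_conj hd
    rw [hmr, Complex.conj_ofReal] at this
    exact this
  have hχ0 : χ β = 0 := by simp only [hχ, Complex.conj_ofReal, h0, map_zero]
  have hsum : ∀ᶠ z in nhdsWithin (β:ℂ) {(β:ℂ)}ᶜ, χ z + φ z ≠ 0 := by
    have := (hχd.add hd).eventually_ne (c := (0:ℂ)) (by
      rw [← two_mul]; exact mul_ne_zero two_ne_zero hm)
    exact this
  have hs1 : ∀ᶠ z in nhds (β:ℂ), ‖φ z‖ < 1 := by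
    have := hd.continuousAt.norm.tendsto
    rw [h0, norm_zero] at this
    exact (tendsto_order.1 this).2 1 one_pos
  have hs2 : ∀ᶠ z in nhds (β:ℂ), ‖χ z‖ < 1 := by
    have := hχd.continuousAt.norm.tendsto
    rw [hχ0, norm_zero] at this
    exact (tendsto_order.1 this).2 1 one_pos
  rw [eventually_nhdsWithin_iff] at hsum
  filter_upwards [hsum, hs1, hs2, hev, hct.eventually hev] with z g1 g2 g3 g4 g5
  suffices h : χ z = φ z by
    rw [← h]; simp [hχ]
  by_cases hz : z = β
  · rw [hz, h0, hχ0]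
  have g1' := g1 hz
  have hcos : Complex.cos (φ z) = Complex.cos (χ z) := by
    have : (starRingEnd ℂ) (D ((starRingEnd ℂ) z)) = D z := by rw [hconj, Complex.conj_conj]
    rw [g5, g4, map_mul, map_mul, hεc, Complex.conj_ofNat, ← Complex.cos_conj] at this
    exact (mul_left_cancel₀ (mul_ne_zero two_ne_zero hε) this).symm
  obtain ⟨n, hn⟩ := Complex.cos_eq_cos_iff.1 hcos
  have hn0 : n = 0 := by
    by_contra hne
    have h1 : (1:ℝ) ≤ |(n:ℝ)| := by exact_mod_cast Int.one_le_abs hne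
    have h2 : ‖(2 * n * Real.pi : ℂ)‖ < 2 := by
      rcases hn with hn | hn
      · have : (2 * n * Real.pi : ℂ) = χ z - φ z := by rw [hn]; ring
        rw [this]; exact (norm_sub_le _ _).trans_lt (by linarith)
      · have : (2 * n * Real.pi : ℂ) = χ z + φ z := by rw [hn]; ring
        rw [this]; exact (norm_add_le _ _).trans_lt (by linarith)
    rw [norm_mul, norm_mul, Complex.norm_intCast, Complex.norm_real, Complex.norm_ofNat,
      Real.norm_eq_abs, abs_of_pos Real.pi_pos] at h2
    nlinarith [Real.pi_gt_three]
  subst hn0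
  rcases hn with hn | hn
  · rw [hn]; simp
  · exfalso; apply g1'; rw [hn]; simp

lemma real_preimage_nonreal (g : ℂ → ℂ) (β : ℝ) (hg : AnalyticAt ℂ g β) (hr : (g β).im = 0)
    (hd : deriv g β = 0) : ¬ ∀ᶠ z in nhds (β:ℂ), (g z).im = 0 → z.im = 0 := by
  intro h
  by_cases hconst : ∀ᶠ z in nhds (β:ℂ), g z - g β = 0
  · have := curve_real (fun z => z - β) β 1 Complex.I
      ((hasStrictDerivAt_id (β:ℂ)).sub_const (β:ℂ)) one_ne_zero (by simp) (by
        filter_upwards [hconst, h] with z h1 h2 _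
        exact h2 (by rw [sub_eq_zero.1 h1, hr]))
    simp at this
  · obtain ⟨n, q, hn, hq, hq0, hq1, hev⟩ := normal_form (fun z => g z - g β) β
      (hg.sub analyticAt_const) (by simp) hconst
    have hn1 : n ≠ 1 := by
      rintro rfl
      have e : (fun z => g z - g β) =ᶠ[nhds (β:ℂ)] q := by
        filter_upwards [hev] with z hz; rw [hz, pow_one]
      have := e.deriv_eq
      rw [deriv_sub_const, hd] at this
      exact hq1 this.symm
    have key : ∀ v : ℂ, (v ^ n).im = 0 → (v / deriv q β).im = 0 := by
      intro v hv
      refine curve_real q β _ v hq.hasStrictDerivAt hq1 hq0 ?_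
      filter_upwards [hev, h] with z h1 h2
      rintro ⟨t, ht⟩
      apply h2
      have : g z = g β + ((t ^ n : ℝ) : ℂ) * v ^ n := by
        rw [ht, mul_pow] at h1
        push_cast
        linear_combination h1
      rw [this, Complex.add_im, hr, Complex.im_ofReal_mul, hv]; simp
    have k1 := key 1 (by simp)
    have hn0 : (n:ℂ) ≠ 0 := Nat.cast_ne_zero.2 hn
    have k2 := key (Complex.exp ((Real.pi / n : ℝ) * Complex.I)) (by
      rw [← Complex.exp_nat_mul]
      have : (n:ℂ) * (((Real.pi / n : ℝ) : ℂ) * Complex.I) = Real.pi * Complex.I := by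
        push_cast; field_simp
      rw [this, Complex.exp_pi_mul_I]; simp)
    set w := 1 / deriv q β with hw
    have hw0 : w ≠ 0 := one_div_ne_zero hq1
    have hwre : w.re ≠ 0 := fun h0 => hw0 (Complex.ext h0 k1)
    rw [show Complex.exp ((Real.pi / n : ℝ) * Complex.I) / deriv q β =
      Complex.exp ((Real.pi / n : ℝ) * Complex.I) * w by rw [hw]; ring, Complex.mul_im, k1,
      Complex.exp_ofReal_mul_I_im, mul_zero, zero_add] at k2
    have hs : 0 < Real.sin (Real.pi / n) := by
      have hn2 : (2:ℝ) ≤ n := by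
        have : 2 ≤ n := by omega
        exact_mod_cast this
      apply Real.sin_pos_of_pos_of_lt_pi
      · have := Real.pi_pos; positivity
      · rw [div_lt_iff₀ (by linarith)]; nlinarith [Real.pi_pos]
    rcases mul_eq_zero.1 k2 with h' | h'
    · exact hs.ne' h'
    · exact hwre h'

lemma complex_core (D : ℂ → ℂ) (hD : Differentiable ℂ D) (β ε d k : ℝ) (hε : ε = 1 ∨ ε = -1)
    (hval : D β = 2 * ε) (h1 : deriv D β = 0) (h2 : deriv (deriv D) β = d) (hd : d ≠ 0)
    (hconj : ∀ z, D ((starRingEnd ℂ) z) = (starRingEnd ℂ) (D z))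
    (hsa : ∀ᶠ s in nhds (β:ℂ), ∀ t : ℝ, D s = 2 * Complex.cos t → s.im = 0) :
    (∃ᶠ s in nhds (β:ℂ), s.im ≠ 0 ∧ ∃ θ : ℝ, D s = 2 * Complex.cos (k * s - θ)) ↔
      k ^ 2 = - ε * d / 2 := by
  have hε2 : (ε:ℂ) ^ 2 = 1 := by rcases hε with h | h <;> rw [h] <;> norm_num
  have hε0 : (ε:ℂ) ≠ 0 := by intro h; rw [h] at hε2; norm_num at hε2
  obtain ⟨φ, m, hφan, hφ0, hφd, hm2, hev⟩ := exists_phase D hD β ε d hε2 hval h1 h2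
    (by exact_mod_cast hd)
  have hm : m ≠ 0 := by
    rintro rfl
    have : (ε:ℂ) * d = 0 := by linear_combination 2 * hm2
    rcases mul_eq_zero.1 this with h | h
    · exact hε0 h
    · exact hd (by exact_mod_cast h)
  -- absorb the sign in a phase shift
  obtain ⟨τ, hτ⟩ : ∃ τ : ℝ, ∀ x : ℂ, (ε:ℂ) * Complex.cos x = Complex.cos (x + τ) := by
    rcases hε with h | h
    · exact ⟨0, fun x => by rw [h]; simp⟩
    · exact ⟨Real.pi, fun x => by rw [h, Complex.cos_add_pi]; simp⟩
  have hev' : ∀ᶠ z in nhds (β:ℂ), D z = 2 * Complex.cos (φ z + τ) := by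
    filter_upwards [hev] with z hz
    rw [hz, mul_assoc, hτ]
  -- realness of m
  have hmim : m.im = 0 := by
    have := curve_real φ β m 1 hφd hm hφ0 (by
      filter_upwards [hev', hsa] with z h1 h2
      rintro ⟨t, ht⟩
      apply h2 (t + τ)
      rw [h1, ht]; push_cast; rw [mul_one])
    rw [one_div, Complex.inv_im, div_eq_zero_iff] at this
    rcases this with h | h
    · linarith
    · exact absurd (Complex.normSq_eq_zero.1 h) hm
  have hmr : (starRingEnd ℂ) m = m := Complex.conj_eq_iff_im.2 hmim
  have hφc := phase_conj D φ β ε m hε0 hconj (Complex.conj_ofReal _) hφ0 hφd.hasDerivAt hm hmr hev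
  have hk : k ^ 2 = - ε * d / 2 ↔ (k:ℂ) ^ 2 = m ^ 2 := by
    rw [hm2]; norm_cast
  rw [hk]
  constructor
  · intro hfreq
    by_contra hne
    have hne1 : (k:ℂ) - m ≠ 0 := fun h => hne (by linear_combination (k + m) * h)
    have hne2 : (k:ℂ) + m ≠ 0 := fun h => hne (by linear_combination (k - m) * h)
    have hct : Tendsto (starRingEnd ℂ) (nhds (β:ℂ)) (nhds (β:ℂ)) := by
      have := (Complex.continuous_conj.tendsto (β:ℂ))
      rwa [Complex.conj_ofReal] at this
    have hlin : HasStrictDerivAt (fun z : ℂ => (k:ℂ) * z) k β := by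
      simpa using (hasStrictDerivAt_id (β:ℂ)).const_mul (k:ℂ)
    have hinj : ∀ (g : ℂ → ℂ) (g' : ℂ), HasStrictDerivAt g g' β → g' ≠ 0 →
        (∀ᶠ z in nhds (β:ℂ), g ((starRingEnd ℂ) z) = (starRingEnd ℂ) (g z)) →
        ∀ᶠ z in nhds (β:ℂ), (g z).im = 0 → z.im = 0 := by
      intro g g' hg hg' hgc
      have hl := hg.eventually_left_inverse hg'
      filter_upwards [hl, hct.eventually hl, hgc] with z a1 a2 a3 him
      rw [a3, Complex.conj_eq_iff_im.2 him, a1] at a2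
      exact Complex.conj_eq_iff_im.1 a2.symm
    have i1 := hinj (fun z => k * z - φ z) _ (hlin.sub hφd) hne1 (by
      filter_upwards [hφc] with z hz; simp [hz])
    have i2 := hinj (fun z => k * z + φ z) _ (hlin.add hφd) hne2 (by
      filter_upwards [hφc] with z hz; simp [hz])
    obtain ⟨s, ⟨hs, θ, hθ⟩, b1, b2, b3⟩ := (hfreq.and_eventually (i1.and (i2.and hev'))).exists
    rw [b3] at hθ
    have hcos := mul_left_cancel₀ two_ne_zero hθ
    obtain ⟨n, hn | hn⟩ := Complex.cos_eq_cos_iff.1 hcos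
    · apply hs; apply b1
      have : (k:ℂ) * s - φ s = ((2 * n * Real.pi + τ + θ : ℝ) : ℂ) := by
        push_cast; linear_combination hn
      rw [this, Complex.ofReal_im]
    · apply hs; apply b2
      have : (k:ℂ) * s + φ s = ((2 * n * Real.pi - τ + θ : ℝ) : ℂ) := by
        push_cast; linear_combination hn
      rw [this, Complex.ofReal_im]
  · intro hkm
    have hgen : ∀ (χ : ℂ → ℂ), AnalyticAt ℂ χ β → χ β = 0 → HasDerivAt χ k β →
        (∀ᶠ z in nhds (β:ℂ), D z = 2 * Complex.cos (χ z + τ)) →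
        ∃ᶠ s in nhds (β:ℂ), s.im ≠ 0 ∧ ∃ θ : ℝ, D s = 2 * Complex.cos (k * s - θ) := by
      intro χ hχ hχ0 hχd hχe
      have hgd : HasDerivAt (fun z => (k:ℂ) * z - χ z) ((k:ℂ) * 1 - k) β :=
        ((hasDerivAt_id (β:ℂ)).const_mul (k:ℂ)).sub hχd
      have := real_preimage_nonreal (fun z => k * z - χ z) β
        ((analyticAt_const.mul analyticAt_id).sub hχ) (by rw [hχ0]; simp)
        (by rw [hgd.deriv]; ring)
      rw [not_eventually] at this
      refine (this.and_eventually hχe).mono ?_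
      rintro z ⟨g1, g2⟩
      push Not at g1
      refine ⟨g1.2, ((k:ℂ) * z - χ z).re - τ, ?_⟩
      rw [g2]
      have e : ((((k:ℂ) * z - χ z).re : ℝ) : ℂ) = k * z - χ z :=
        Complex.ext (by simp) (by rw [Complex.ofReal_im, g1.1])
      congr 2
      push_cast
      rw [e]; ring
    have : ((k:ℂ) - m) * (k + m) = 0 := by linear_combination hkm
    rcases mul_eq_zero.1 this with h | h
    · have hk' : m = k := by linear_combination -h
      rw [hk'] at hφd
      exact hgen φ hφan hφ0 hφd.hasDerivAt hev'
    · have hk' : -m = k := by linear_combination -h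
      refine hgen (fun z => -φ z) hφan.neg (by simp [hφ0]) (hk' ▸ hφd.hasDerivAt.neg) ?_
      filter_upwards [hev] with z hz
      rw [hz, ← hτ, Complex.cos_neg, mul_assoc]

lemma real_deriv (F : ℂ → ℂ) (g : ℝ → ℝ) (hF : Differentiable ℂ F) (h : ∀ x : ℝ, F x = g x)
    (x : ℝ) : deriv F x = (deriv g x : ℝ) := by
  have h1 : HasDerivAt (fun x : ℝ => F x) (deriv F x) x := (hF x).hasDerivAt.comp_ofReal
  have h2 : HasDerivAt g (deriv F x).re x := by
    have := (hF x).hasDerivAt.real_of_complex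
    simpa [h] using this
  have h3 := h2.ofReal_comp
  have h4 : (fun x : ℝ => F x) = fun x => (g x : ℂ) := funext h
  rw [h4] at h1
  rw [h2.deriv]
  exact h1.unique h3

lemma IsSolC.conj {P : ℝ → ℝ} {ν : ℂ} {y yd : ℝ → ℂ} (h : IsSolC (fun z => ν - P z) y yd) :
    IsSolC (fun z => (starRingEnd ℂ) ν - P z) (fun z => (starRingEnd ℂ) (y z))
      (fun z => (starRingEnd ℂ) (yd z)) := by
  refine ⟨fun z => (h.1 z).star, fun z => ?_⟩
  have := (h.2 z).star
  refine this.congr_deriv ?_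
  simp

theorem dhh_double_point_characterization
    (V : ℝ → ℝ) (hV : ContDiff ℝ 2 V)
    (c : ℝ) (hc : c ^ 2 ≠ 1)
    (f fd fdd : ℝ → ℝ)
    (hf : ∀ z, HasDerivAt f (fd z) z)
    (hfd : ∀ z, HasDerivAt fd (fdd z) z)
    (hwave : ∀ z, (c ^ 2 - 1) * fdd z + deriv V (f z) = 0)
    (T : ℝ) (hT : 0 < T)
    (hper : ∀ z, fd (z + T) = fd z)
    (hnt : ∃ z, fd z ≠ 0)
    (Q : ℝ → ℝ) (hQ : Q = fun z => deriv (deriv V) (f z))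
    (P : ℝ → ℝ) (hP : P = fun z => Q z / (c ^ 2 - 1))
    (y1 y1d y2 y2d : ℝ → ℝ → ℝ)
    (hfund : IsHillFundamental P y1 y1d y2 y2d)
    (Δ : ℝ → ℝ) (hΔ : Δ = fun ν => y1 ν T + y2d ν T)
    (β : ℝ) (hβ : β ≠ 0)
    (ν₀ : ℝ) (hν₀ : ν₀ = -β ^ 2 / (c ^ 2 - 1) ^ 2)
    (ε : ℝ) (hε : ε = 1 ∨ ε = -1)
    (hval : Δ ν₀ = 2 * ε)
    (hcrit : deriv Δ ν₀ = 0)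
    (hsecond : deriv (deriv Δ) ν₀ ≠ 0) :
    HasDHHInstabilityAt c Q (Complex.I * β) ↔
      c ^ 2 * T ^ 2 * (c ^ 2 - 1) ^ 2 = -2 * ε * β ^ 2 * deriv (deriv Δ) ν₀ := by
  have hd : c ^ 2 - 1 ≠ 0 := sub_ne_zero.2 hc
  have hPper : ∀ z, P (z + T) = P z := by
    intro z
    rw [hP, hQ]
    simp only
    rw [potential_periodic V c f fd fdd hf hfd hwave T hper z]
  obtain ⟨g1, g2, g3, g4, g5, g6, g7, g8⟩ := hfund ν₀
  obtain ⟨Y1, Y1d, Y2, Y2d, hF, han1, han2⟩ :=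
    hill_complex P ν₀ (y1 ν₀) (y1d ν₀) (y2 ν₀) (y2d ν₀) g1 g2 g3 g4 g5 g6 g7 g8
  set DC : ℂ → ℂ := fun ν => Y1 ν T + Y2d ν T with hDC
  have hDCan : Differentiable ℂ DC := (han1 T).add (han2 T)
  have hDC1 : Differentiable ℂ (deriv DC) := fun z =>
    (hDCan.analyticAt z).deriv.differentiableAt
  have hreal : ∀ x : ℝ, DC x = Δ x := by
    intro x
    obtain ⟨k1, k2, k3, k4, k5, k6, k7, k8⟩ := hfund x
    have s1 : IsSolC (fun z => (x:ℂ) - P z) (fun z => (y1 x z : ℂ)) (fun z => (y1d x z : ℂ)) := by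
      refine ⟨fun z => (k1 z).ofReal_comp, fun z => (k2 z).ofReal_comp.congr_deriv ?_⟩
      push_cast; ring
    have s2 : IsSolC (fun z => (x:ℂ) - P z) (fun z => (y2 x z : ℂ)) (fun z => (y2d x z : ℂ)) := by
      refine ⟨fun z => (k3 z).ofReal_comp, fun z => (k4 z).ofReal_comp.congr_deriv ?_⟩
      push_cast; ring
    have e1 := ((hF x).repr s1 T).1
    have e2 := ((hF x).repr s2 T).2
    simp only [k5, k6, k7, k8, Complex.ofReal_one, Complex.ofReal_zero, one_mul, zero_mul, add_zero,
      zero_add] at e1 e2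
    rw [hΔ, hDC]
    simp only
    push_cast
    rw [e1, e2]
  have hDCconj : ∀ ν, DC ((starRingEnd ℂ) ν) = (starRingEnd ℂ) (DC ν) := by
    intro ν
    obtain ⟨s1, s2, k5, k6, k7, k8⟩ := hF ν
    have e1 := ((hF ((starRingEnd ℂ) ν)).repr s1.conj T).1
    have e2 := ((hF ((starRingEnd ℂ) ν)).repr s2.conj T).2
    simp only [k5, k6, k7, k8, map_one, map_zero, one_mul, zero_mul, add_zero, zero_add] at e1 e2
    simp only [hDC, map_add]
    rw [e1, e2]
  have hder1 := real_deriv DC Δ hDCan hreal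
  have hder2 := real_deriv (deriv DC) (deriv Δ) hDC1 hder1
  set N : ℂ → ℂ := fun s => -s ^ 2 / ((c : ℂ) ^ 2 - 1) ^ 2 with hN
  have hNβ : N β = ν₀ := by rw [hν₀, hN]; push_cast; rfl
  have hNd : ∀ s, HasDerivAt N (-2 * s / ((c : ℂ) ^ 2 - 1) ^ 2) s := by
    intro s
    refine ((((hasDerivAt_id s).pow 2).neg).div_const _).congr_deriv ?_
    simp
  have hNan : Differentiable ℂ N := fun s => (hNd s).differentiableAt
  set D : ℂ → ℂ := fun s => DC (N s) with hDdef
  have hDd : ∀ s, HasDerivAt D (deriv DC (N s) * (-2 * s / ((c : ℂ) ^ 2 - 1) ^ 2)) s :=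
    fun s => (hDCan (N s)).hasDerivAt.comp s (hNd s)
  have hDan : Differentiable ℂ D := fun s => (hDd s).differentiableAt
  have hD' : deriv D = fun s => deriv DC (N s) * (-2 * s / ((c : ℂ) ^ 2 - 1) ^ 2) :=
    funext fun s => (hDd s).deriv
  set A := deriv (deriv Δ) ν₀ with hA
  have hD'' : deriv (deriv D) β = ((A * (4 * β ^ 2 / (c ^ 2 - 1) ^ 4) : ℝ) : ℂ) := by
    have e1 : HasDerivAt (fun s : ℂ => -2 * s / ((c : ℂ) ^ 2 - 1) ^ 2)
        (-2 / ((c : ℂ) ^ 2 - 1) ^ 2) (β:ℂ) := by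
      refine (((hasDerivAt_id (β:ℂ)).const_mul (-2)).div_const _).congr_deriv ?_
      simp
    have e2 := ((hDC1 (N β)).hasDerivAt.comp (β:ℂ) (hNd β)).mul e1
    rw [hD']
    refine e2.deriv.trans ?_
    simp only [Function.comp]
    rw [hNβ, hder1, hder2, hcrit, ← hA]
    push_cast
    have : (c:ℂ) ^ 2 - 1 ≠ 0 := by exact_mod_cast hd
    field_simp
    ring
  have hcore := complex_core D hDan β ε (A * (4 * β ^ 2 / (c ^ 2 - 1) ^ 4)) (c * T / (c ^ 2 - 1)) hε
    (by simp only [hDdef]; rw [hNβ, hreal, hval]; push_cast; rfl)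
    (by rw [hD']; simp only; rw [hNβ, hder1, hcrit]; simp)
    hD'' (by positivity)
    (by
      intro z
      simp only [hDdef]
      rw [← hDCconj]
      simp [hN])
    (by
      have hre : ∀ᶠ s in nhds (β:ℂ), s.re ≠ 0 := by
        apply Complex.continuous_re.continuousAt.eventually_ne
        simpa using hβ
      filter_upwards [hre] with s hs t ht
      have hq : ∀ z, (fun z => N s - (P z : ℂ)) (z + T) = (fun z => N s - (P z : ℂ)) z := by
        intro z; simp only [hPper]
      have ht' : Y1 (N s) T + Y2d (N s) T = 2 * Complex.cos t := ht
      obtain ⟨y, yd, hy, hyne, hy1, hy2⟩ := (hF (N s)).floquet T hq (Complex.exp (t * Complex.I)) (by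
        rw [ht', Complex.two_cos]
        have hinv : Complex.exp (t * Complex.I) * Complex.exp (-t * Complex.I) = 1 := by
          rw [← Complex.exp_add, ← Complex.exp_zero]; congr 1; ring
        linear_combination -hinv)
      have him := selfadjoint_real P (N s) T hT y yd hy hyne _
        (Complex.norm_exp_ofReal_mul_I t) hy1 hy2
      have hN' : N s = (((-1 / (c ^ 2 - 1) ^ 2 : ℝ)) : ℂ) * s ^ 2 := by
        simp only [hN]; push_cast; ring
      rw [hN', Complex.im_ofReal_mul] at him
      have h0 : (-1 / (c ^ 2 - 1) ^ 2 : ℝ) ≠ 0 := by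
        apply div_ne_zero (by norm_num) (pow_ne_zero 2 hd)
      have h1 := (mul_eq_zero.1 him).resolve_left h0
      rw [pow_two, Complex.mul_im] at h1
      have h2 : s.re * s.im = 0 := by linarith
      exact (mul_eq_zero.1 h2).resolve_left hs)
  have hspec : ∀ s : ℂ, Complex.I * s ∈ KGSpectrum c Q ↔ ∃ θ : ℝ,
      D s = 2 * Complex.cos (((c * T / (c ^ 2 - 1) : ℝ) : ℂ) * s - θ) := fun s =>
    spectrum_iff_cos c hc Q P hP T hT hPper s _ _ _ _ (hF (N s))
  have hleft : HasDHHInstabilityAt c Q (Complex.I * β) ↔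
      ∃ᶠ s in nhds (β:ℂ), s.im ≠ 0 ∧ ∃ θ : ℝ,
        D s = 2 * Complex.cos (((c * T / (c ^ 2 - 1) : ℝ) : ℂ) * s - θ) := by
    have t1 : Tendsto (fun s : ℂ => Complex.I * s) (nhds (β:ℂ)) (nhds (Complex.I * β)) :=
      (continuous_const.mul continuous_id).tendsto _
    have t2 : Tendsto (fun l : ℂ => -Complex.I * l) (nhds (Complex.I * β)) (nhds (β:ℂ)) := by
      have h0 : -Complex.I * (Complex.I * β) = β := by
        linear_combination (-(β:ℂ)) * Complex.I_sq
      have : Tendsto (fun l : ℂ => -Complex.I * l) (nhds (Complex.I * β))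
          (nhds (-Complex.I * (Complex.I * β))) := (continuous_const.mul continuous_id).tendsto _
      rwa [h0] at this
    constructor
    · intro h
      rw [frequently_iff]
      intro U hU
      obtain ⟨l, hl, hlU, hlre⟩ := h _ (t2 hU)
      refine ⟨-Complex.I * l, hlU, by simpa using hlre, (hspec _).1 ?_⟩
      have : Complex.I * (-Complex.I * l) = l := by linear_combination (-l) * Complex.I_sq
      rwa [this]
    · intro h U hU
      obtain ⟨s, hs, hsim, hsθ⟩ := frequently_iff.1 h (t1 hU)
      exact ⟨Complex.I * s, (hspec s).2 hsθ, hs, by simpa using hsim⟩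
  rw [hleft, hcore]
  have hd4 : (c ^ 2 - 1) ^ 4 ≠ 0 := pow_ne_zero 4 hd
  rw [div_pow, div_eq_iff (pow_ne_zero 2 hd)]
  have e : -ε * (A * (4 * β ^ 2 / (c ^ 2 - 1) ^ 4)) / 2 * (c ^ 2 - 1) ^ 2 =
      (-2 * ε * β ^ 2 * A) / (c ^ 2 - 1) ^ 2 := by
    field_simp
    ring
  rw [e, eq_div_iff (pow_ne_zero 2 hd), mul_pow]
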